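/- If a college c can beneficially manipulate the student-optimal stable mechanism via misrepresenting its preferences while all other agents report truthfully, then there also exists a beneficial manipulation by c whose outcome μ'' satisfies |μ(c) \ μ''(c)| = 1, where μ is the truthful outcome; that is, a beneficial manipulation exists in which c loses exactly one of its truthful matches. -/

import Mathlib

/-- A college admissions market: capacities `q` (each at least 1) and, for every
student and every college, a strict complete preference list, modelled as a
`LinearOrder` in which *greater* means *more preferred*. -/
structure Market (S C : Type*) [Fintype S] [Fintype C] where
  q : C → ℕ
  q_pos : ∀ c, 1 ≤ q c
  sPref : S → LinearOrder C
  cPref : C → LinearOrder S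

variable {S C : Type*} [Fintype S] [Fintype C]

/-- Student `s` strictly prefers college `c` to college `c'`. -/
def Market.sprefers (M : Market S C) (s : S) (c c' : C) : Prop :=
  (M.sPref s).lt c' c

/-- College `c` strictly prefers student `s` to student `s'`. -/
def Market.cprefers (M : Market S C) (c : C) (s s' : S) : Prop :=
  (M.cPref c).lt s' s

/-- A matching: each college gets a set of students within its capacity, and the
sets of distinct colleges are disjoint (so each student has at most one college). -/
structure Matching (M : Market S C) where
  assign : C → Finset S
  card_le : ∀ c, (assign c).card ≤ M.q c
  disjoint : ∀ c c', c ≠ c' → Disjoint (assign c) (assign c')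

/-- `(s, c)` is a blocking pair: `s` is unmatched or prefers `c` to his current
college, and `c` has a free slot or prefers `s` to one of its current students. -/
def Blocks (M : Market S C) (μ : Matching M) (s : S) (c : C) : Prop :=
  (∀ c', s ∈ μ.assign c' → M.sprefers s c c') ∧
  ((μ.assign c).card < M.q c ∨ ∃ s' ∈ μ.assign c, M.cprefers c s s')

/-- A matching is stable if it admits no blocking pair. -/
def Stable (M : Market S C) (μ : Matching M) : Prop :=
  ∀ s c, ¬ Blocks M μ s c

/-- Student `s` weakly prefers his assignment under `μ` to his assignment under `ν`:
either the assignments coincide, or `s` is matched under `μ` to a college that he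
strictly prefers to his situation under `ν` (being matched beats being unmatched). -/
def SWeakPref (M : Market S C) (μ ν : Matching M) (s : S) : Prop :=
  (∀ c, s ∈ μ.assign c ↔ s ∈ ν.assign c) ∨
  ∃ c, s ∈ μ.assign c ∧
    ((∀ c', s ∉ ν.assign c') ∨ ∃ c', s ∈ ν.assign c' ∧ M.sprefers s c c')

/-- The student-optimal stable matching. -/
def StudentOptimal (M : Market S C) (μ : Matching M) : Prop :=
  Stable M μ ∧ ∀ ν : Matching M, Stable M ν → ∀ s, SWeakPref M μ ν s

/-- `X` (weakly) responsively dominates `Y` w.r.t. college `c`'s preferences: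
there is an injection `g : Y → X` with `g s = s` or `g s >_c s` for all `s ∈ Y`. -/
def RespDominates (M : Market S C) (c : C) (X Y : Finset S) : Prop :=
  ∃ g : S → S, Set.InjOn g ↑Y ∧ (∀ s ∈ Y, g s ∈ X) ∧
    ∀ s ∈ Y, g s = s ∨ M.cprefers c (g s) s

/-- Strict responsive domination. -/
def StrictRespDominates (M : Market S C) (c : C) (X Y : Finset S) : Prop :=
  X ≠ Y ∧ RespDominates M c X Y

/-- The college-optimal stable matching. -/
def CollegeOptimal (M : Market S C) (μ : Matching M) : Prop :=
  Stable M μ ∧ ∀ ν : Matching M, Stable M ν → ∀ c, RespDominates M c (μ.assign c) (ν.assign c)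

/-- The market in which college `c` reports the list `P` instead of its true list,
while everything else is unchanged. -/
def replaceCPref [DecidableEq C] (M : Market S C) (c : C) (P : LinearOrder S) :
    Market S C :=
  { M with cPref := Function.update M.cPref c P }

/-- The market in which student `s` reports the list `P` instead of his true list,
while everything else is unchanged. -/
def replaceSPref [DecidableEq S] (M : Market S C) (s : S) (P : LinearOrder C) :
    Market S C :=
  { M with sPref := Function.update M.sPref s P }

/-- Preferences of a student over the copies of the colleges in the associated
one-to-one market: copies of colleges are compared according to the student's order
over colleges, and within a block of copies smaller index is better. -/
def assocSPref (M : Market S C) (s : S) : LinearOrder ((c : C) × Fin (M.q c)) :=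
  letI := M.sPref s
  LinearOrder.lift' (fun x => toLex ((x.1 : C), (M.q x.1 - (x.2 : ℕ)))) (by
    rintro ⟨c, i⟩ ⟨c', j⟩ h
    have h' : ((c : C), M.q c - (i : ℕ)) = (c', M.q c' - (j : ℕ)) := toLex.injective h
    have h1 : c = c' := congrArg Prod.fst h'
    subst h1
    have h2 : M.q c - (i : ℕ) = M.q c - (j : ℕ) := congrArg Prod.snd h'
    have hi := i.isLt
    have hj := j.isLt
    have : (i : ℕ) = (j : ℕ) := by omega
    exact congrArg (Sigma.mk c) (Fin.ext this))

/-- The associated one-to-one market: college `c` is replaced by `q c` copies,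
each of capacity one and with `c`'s preferences over students; students' preferences
over copies are induced blockwise from their preferences over colleges. -/
def assocMarket (M : Market S C) : Market S ((c : C) × Fin (M.q c)) :=
  { q := fun _ => 1
    q_pos := fun _ => le_refl 1
    sPref := assocSPref M
    cPref := fun x => M.cPref x.1 }

section DeferredAcceptance

open Set

/-- Cumulative applications: `x` has applied to every college all of whose superiors in the
list of `x` have rejected `x`. -/
def cumApps {S C : Type*} (pref : S → LinearOrder C) : (C → Set S) →o (C → Set S) where
  toFun R d := {x | ∀ d', (pref x).lt d d' → x ∈ R d'}
  monotone' _ _ h _ _ hx d' hd := h d' (hx d' hd)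

/-- One round of deferred acceptance, in terms of the sets of rejected students. -/
def rejStep {S C : Type*} (pref : S → LinearOrder C) (rule : C → Set S →o Set S) :
    (C → Set S) →o (C → Set S) where
  toFun R d := rule d (cumApps pref R d)
  monotone' _ _ h d := (rule d).monotone ((cumApps pref).monotone h d)

/-- The students rejected by each college in the course of deferred acceptance. -/
def rejections {S C : Type*} (pref : S → LinearOrder C) (rule : C → Set S →o Set S) :
    C → Set S :=
  (rejStep pref rule).lfp

/-- The students applying to each college in the course of deferred acceptance. -/
def applicants {S C : Type*} (pref : S → LinearOrder C) (rule : C → Set S →o Set S) :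
    C → Set S :=
  cumApps pref (rejections pref rule)

/-- The outcome of deferred acceptance. -/
def held {S C : Type*} (pref : S → LinearOrder C) (rule : C → Set S →o Set S) (d : C) : Set S :=
  applicants pref rule d \ rejections pref rule d

/-- The rejection rule of a college with quota `q` and list `P`. -/
def quotaRule {S : Type*} [Fintype S] (P : LinearOrder S) (q : ℕ) : Set S →o Set S where
  toFun X := {x | x ∈ X ∧ q ≤ {y | y ∈ X ∧ P.lt x y}.ncard}
  monotone' _ _ h _ hx :=
    ⟨h hx.1, hx.2.trans (ncard_le_ncard (fun _ hy => ⟨h hy.1, hy.2⟩) (toFinite _))⟩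

/-- The rejection rule of a college that rejects exactly the students in `K`. -/
def avoidRule {S : Type*} (K : Set S) : Set S →o Set S where
  toFun X := X ∩ K
  monotone' _ _ h := inter_subset_inter_left K h

/-- The order comparing students first by tier and then by `P`. -/
@[reducible] def tiered {S : Type*} (P : LinearOrder S) (t : S → ℕ) : LinearOrder S :=
  letI := P
  LinearOrder.lift' (fun x => toLex (t x, x)) fun _ _ h => congrArg Prod.snd (toLex.injective h)

theorem tiered_lt {S : Type*} (P : LinearOrder S) (t : S → ℕ) (x y : S) :
    (tiered P t).lt x y ↔ t x < t y ∨ t x = t y ∧ P.lt x y := by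
  let := P
  exact Prod.Lex.toLex_lt_toLex

section QuotaRule

variable {S : Type*} [Fintype S] (P : LinearOrder S) (q : ℕ) (X : Set S)

theorem lt_of_mem_quotaRule {x y : S} (hx : x ∈ quotaRule P q X) (hy : y ∈ X \ quotaRule P q X) :
    P.lt x y := by
  let := P
  by_contra h
  have hle : y ≤ x := not_lt.1 h
  exact hy.2 ⟨hy.1, hx.2.trans
    (ncard_le_ncard (fun _ hz => ⟨hz.1, hle.trans_lt hz.2⟩) (toFinite _))⟩

theorem ncard_diff_quotaRule_le : (X \ quotaRule P q X).ncard ≤ q := by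
  let := P
  by_contra! h
  have hne : (X \ quotaRule P q X).Nonempty := by
    rw [← ncard_pos]; omega
  obtain ⟨m, hm, hmin⟩ := exists_min_image _ id (toFinite (X \ quotaRule P q X)) hne
  refine hm.2 ⟨hm.1, ?_⟩
  have h1 := ncard_sdiff_singleton_add_one hm (toFinite _)
  have h2 : (X \ quotaRule P q X) \ {m} ⊆ {y | y ∈ X ∧ P.lt m y} := fun y hy =>
    ⟨hy.1.1, lt_of_le_of_ne (hmin y hy.1) fun e => hy.2 e.symm⟩
  have h3 := ncard_le_ncard h2 (toFinite _)
  omega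

theorem le_ncard_diff_quotaRule (h : (quotaRule P q X).Nonempty) :
    q ≤ (X \ quotaRule P q X).ncard := by
  let := P
  obtain ⟨m, hm, hmax⟩ := exists_max_image _ id (toFinite (quotaRule P q X)) h
  refine hm.2.trans (ncard_le_ncard (fun y hy => ⟨hy.1, fun hr => ?_⟩) (toFinite _))
  exact absurd hy.2 (not_lt.2 (hmax y hr))

theorem ncard_diff_quotaRule_mono {Y : Set S} (h : X ⊆ Y) :
    (X \ quotaRule P q X).ncard ≤ (Y \ quotaRule P q Y).ncard := by
  rcases (quotaRule P q Y).eq_empty_or_nonempty with hY | hY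
  · rw [hY, sdiff_empty]
    exact ncard_le_ncard (sdiff_subset.trans h) (toFinite _)
  · exact (ncard_diff_quotaRule_le P q X).trans (le_ncard_diff_quotaRule P q Y hY)

end QuotaRule

section Rejections

variable {S C : Type*} (pref : S → LinearOrder C) (rule : C → Set S →o Set S)

theorem rejections_apply (d : C) : rejections pref rule d = rule d (applicants pref rule d) :=
  (congrFun (rejStep pref rule).map_lfp d).symm

theorem applicants_mono {rule' : C → Set S →o Set S}
    (h : rejections pref rule ≤ rejections pref rule') :
    applicants pref rule ≤ applicants pref rule' :=
  (cumApps pref).monotone h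

/-- Rules agreeing off `c` compare as soon as the rejections by `c` compare. -/
theorem rejections_le_of_college {rule rule' : C → Set S →o Set S} (c : C)
    (hoff : ∀ d, d ≠ c → rule d = rule' d)
    (hc : ∀ x ∈ rule c (cumApps pref (rejections pref rule ⊓ rejections pref rule') c),
      x ∈ rejections pref rule c → x ∈ rejections pref rule' c) :
    rejections pref rule ≤ rejections pref rule' := by
  have key : rejStep pref rule (rejections pref rule ⊓ rejections pref rule')
      ≤ rejections pref rule ⊓ rejections pref rule' := by
    have h1 : rejStep pref rule (rejections pref rule ⊓ rejections pref rule')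
        ≤ rejections pref rule :=
      ((rejStep pref rule).monotone inf_le_left).trans (rejStep pref rule).map_lfp.le
    refine le_inf h1 fun d => ?_
    by_cases hd : d = c
    · subst hd
      exact fun x hx => hc x hx (h1 d hx)
    · rw [rejections_apply pref rule', ← hoff d hd]
      exact (rule d).monotone ((cumApps pref).monotone inf_le_right d)
  exact ((rejStep pref rule).lfp_le key).trans inf_le_right

theorem cumApps_inf_subset {rule rule' : C → Set S →o Set S} (d : C) :
    cumApps pref (rejections pref rule ⊓ rejections pref rule') d ⊆ applicants pref rule' d :=
  (cumApps pref).monotone inf_le_right d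

theorem eq_of_mem_held {d d' : C} {x : S} (h : x ∈ held pref rule d) (h' : x ∈ held pref rule d') :
    d = d' := by
  let := pref x
  rcases lt_trichotomy d d' with hlt | heq | hlt
  · exact absurd (h.1 d' hlt) h'.2
  · exact heq
  · exact absurd (h'.1 d hlt) h.2

theorem exists_mem_held [Finite C] {x : S} {d : C} (h : x ∉ rejections pref rule d) :
    ∃ d', x ∈ held pref rule d' ∧ (pref x).le d d' := by
  let := pref x
  obtain ⟨m, hm, hmax⟩ := exists_max_image {d | x ∉ rejections pref rule d} id (toFinite _) ⟨d, h⟩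
  refine ⟨m, ⟨fun d' hd' => ?_, hm⟩, hmax d h⟩
  by_contra hn
  exact absurd hd' (not_lt.2 (hmax d' hn))

theorem iUnion_held_union [Finite C] :
    (⋃ d, held pref rule d) ∪ {x | ∀ d, x ∈ rejections pref rule d} = univ := by
  refine eq_univ_of_forall fun x => ?_
  by_cases h : ∀ d, x ∈ rejections pref rule d
  · exact Or.inr h
  · push Not at h
    obtain ⟨d, hd⟩ := h
    obtain ⟨d', hd', -⟩ := exists_mem_held pref rule hd
    exact Or.inl (mem_iUnion.2 ⟨d', hd'⟩)

theorem sum_ncard_held [Fintype S] [Fintype C] :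
    ∑ d, (held pref rule d).ncard + {x | ∀ d, x ∈ rejections pref rule d}.ncard
      = Nat.card S := by
  classical
  rw [← ncard_univ, ← iUnion_held_union pref rule, ncard_union_eq _ (toFinite _) (toFinite _)]
  · congr 1
    rw [ncard_iUnion_of_finite (fun _ => toFinite _), finsum_eq_sum_of_fintype]
    exact fun d d' hne => Set.disjoint_left.2 fun x hx hx' => hne (eq_of_mem_held pref rule hx hx')
  · rw [Set.disjoint_left]
    rintro x hx hx'
    obtain ⟨d, hd⟩ := mem_iUnion.1 hx
    exact hd.2 (hx' d)

/-- More rejections leave the college at which the rules differ with fewer students. -/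
theorem ncard_held_anti [Fintype S] [Fintype C] {rule rule' : C → Set S →o Set S} (c : C)
    (hoff : ∀ d, d ≠ c → rule d = rule' d)
    (hmono : ∀ d, d ≠ c → ∀ X Y : Set S, X ⊆ Y → (X \ rule d X).ncard ≤ (Y \ rule d Y).ncard)
    (hle : rejections pref rule ≤ rejections pref rule') :
    (held pref rule' c).ncard ≤ (held pref rule c).ncard := by
  classical
  have h1 := sum_ncard_held pref rule
  have h2 := sum_ncard_held pref rule'
  rw [← Finset.add_sum_erase _ _ (Finset.mem_univ c)] at h1 h2
  have h3 : {x | ∀ d, x ∈ rejections pref rule d}.ncard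
      ≤ {x | ∀ d, x ∈ rejections pref rule' d}.ncard :=
    ncard_le_ncard (fun x hx d => hle d (hx d)) (toFinite _)
  have h4 : ∑ d ∈ Finset.univ.erase c, (held pref rule d).ncard
      ≤ ∑ d ∈ Finset.univ.erase c, (held pref rule' d).ncard := by
    refine Finset.sum_le_sum fun d hd => ?_
    have hd := Finset.ne_of_mem_erase hd
    unfold held
    rw [rejections_apply, rejections_apply, ← hoff d hd]
    exact hmono d hd _ _ (applicants_mono pref rule hle d)
  omega

end Rejections

/-- The rejection rules of the colleges of a market. -/
def Market.rules {S C : Type*} [Fintype S] [Fintype C] (M : Market S C) (d : C) : Set S →o Set S :=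
  quotaRule (M.cPref d) (M.q d)

section StudentOptimal

variable {S C : Type*} [Fintype S] [Fintype C] (M : Market S C)

/-- The matching produced by student-proposing deferred acceptance. -/
noncomputable def daMatching : Matching M where
  assign d := (toFinite (held M.sPref M.rules d)).toFinset
  card_le d := by
    rw [← ncard_eq_toFinset_card, held, rejections_apply]
    exact ncard_diff_quotaRule_le _ _ _
  disjoint d d' hne := by
    rw [Finset.disjoint_left]
    intro x hx hx'
    rw [Finite.mem_toFinset] at hx hx'
    exact hne (eq_of_mem_held _ _ hx hx')

theorem mem_daMatching {x : S} {d : C} :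
    x ∈ (daMatching M).assign d ↔ x ∈ held M.sPref M.rules d :=
  Finite.mem_toFinset _

theorem daMatching_stable : Stable M (daMatching M) := by
  rintro x d ⟨hx, hd⟩
  have hrej : x ∈ rejections M.sPref M.rules d := by
    by_contra h
    obtain ⟨d', hd', hle⟩ := exists_mem_held _ _ h
    let := M.sPref x
    exact absurd (hx d' ((mem_daMatching M).2 hd')) (not_lt.2 hle)
  rw [rejections_apply] at hrej
  rcases hd with hlt | ⟨y, hy, hxy⟩
  · have := le_ncard_diff_quotaRule _ _ _ ⟨x, hrej⟩
    rw [daMatching, ← ncard_eq_toFinset_card, held, rejections_apply] at hlt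
    exact absurd hlt (not_lt.2 this)
  · rw [mem_daMatching, held, rejections_apply] at hy
    let := M.cPref d
    exact lt_asymm (lt_of_mem_quotaRule _ _ _ hrej hy) hxy

theorem notMem_rejections_of_stable {ν : Matching M} (hν : Stable M ν) {x : S} {d : C}
    (hx : x ∈ ν.assign d) : x ∉ rejections M.sPref M.rules d := by
  suffices h : rejections M.sPref M.rules ≤ fun d => {x | x ∉ ν.assign d} from fun hr => h d hr hx
  refine (rejStep M.sPref M.rules).lfp_le fun d x hx hxd => ?_
  obtain ⟨-, hq⟩ := hx
  have hcard : ((ν.assign d : Set S) \ {x}).ncard < M.q d := by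
    have h1 := ncard_sdiff_singleton_add_one (Finset.mem_coe.2 hxd) (toFinite _)
    have h2 := ν.card_le d
    rw [ncard_coe_finset] at h1
    omega
  obtain ⟨y, ⟨hy, hxy⟩, hyn⟩ := exists_mem_notMem_of_ncard_lt_ncard (hcard.trans_le hq)
  let := M.cPref d
  have hne : y ≠ x := (show x < y from hxy).ne'
  have hyd : y ∉ ν.assign d := fun h => hyn ⟨h, hne⟩
  refine hν y d ⟨fun d' hd' => ?_, Or.inr ⟨x, hxd, hxy⟩⟩
  let := M.sPref y
  by_contra h
  rcases (not_lt.1 h).lt_or_eq with h | h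
  · exact hy d' h hd'
  · exact hyd (h ▸ hd')

theorem daMatching_studentOptimal : StudentOptimal M (daMatching M) := by
  refine ⟨daMatching_stable M, fun ν hν x => ?_⟩
  by_cases hm : ∃ d, x ∈ ν.assign d
  · obtain ⟨d, hd⟩ := hm
    obtain ⟨d', hd', hle⟩ := exists_mem_held _ _ (notMem_rejections_of_stable M hν hd)
    let := M.sPref x
    rcases (show d ≤ d' from hle).lt_or_eq with h | rfl
    · exact Or.inr ⟨d', (mem_daMatching M).2 hd', Or.inr ⟨d, hd, h⟩⟩
    · refine Or.inl fun e => ⟨fun he => ?_, fun he => ?_⟩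
      · rwa [← eq_of_mem_held _ _ hd' ((mem_daMatching M).1 he)]
      · by_cases hde : d = e
        · exact hde ▸ (mem_daMatching M).2 hd'
        · exact absurd he (Finset.disjoint_left.1 (ν.disjoint d e hde) hd)
  · push Not at hm
    by_cases hx : ∃ d, x ∈ (daMatching M).assign d
    · obtain ⟨d, hd⟩ := hx
      exact Or.inr ⟨d, hd, Or.inl hm⟩
    · push Not at hx
      exact Or.inl fun d => iff_of_false (hx d) (hm d)

theorem Matching.eq_of_mem {M : Market S C} (μ : Matching M) {x : S} {d d' : C}
    (h : x ∈ μ.assign d) (h' : x ∈ μ.assign d') : d = d' := by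
  by_contra hne
  exact Finset.disjoint_left.1 (μ.disjoint d d' hne) h h'

theorem SWeakPref.antisymm {M : Market S C} {μ ν : Matching M} {x : S}
    (h : SWeakPref M μ ν x) (h' : SWeakPref M ν μ x) (d : C) :
    x ∈ μ.assign d ↔ x ∈ ν.assign d := by
  rcases h with h | ⟨e, he, h⟩
  · exact h d
  rcases h' with h' | ⟨f, hf, h'⟩
  · exact (h' d).symm
  rcases h with h | ⟨f', hf', h⟩
  · exact absurd hf (h f)
  rcases h' with h' | ⟨e', he', h'⟩
  · exact absurd he (h' e)
  obtain rfl := μ.eq_of_mem he he'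
  obtain rfl := ν.eq_of_mem hf hf'
  let := M.sPref x
  exact absurd (show f < e from h) (lt_asymm h')

theorem StudentOptimal.coe_assign {M : Market S C} {μ : Matching M} (h : StudentOptimal M μ)
    (d : C) : (μ.assign d : Set S) = held M.sPref M.rules d := by
  ext x
  rw [Finset.mem_coe, ← mem_daMatching]
  exact SWeakPref.antisymm (h.2 _ (daMatching_stable M) x)
    ((daMatching_studentOptimal M).2 _ h.1 x) d

end StudentOptimal

theorem rules_replaceCPref {S C : Type*} [Fintype S] [Fintype C] [DecidableEq C]
    (M : Market S C) (c : C) (P : LinearOrder S) :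
    (replaceCPref M c P).rules = Function.update M.rules c (quotaRule P (M.q c)) := by
  funext d
  by_cases hd : d = c
  · subst hd; simp [Market.rules, replaceCPref]
  · simp [Market.rules, replaceCPref, hd]

section OneCollege

variable {S C : Type*} [DecidableEq C] (pref : S → LinearOrder C)
  (rest : C → Set S →o Set S) (c : C)

theorem rejections_update (ρ : Set S →o Set S) :
    rejections pref (Function.update rest c ρ) c
      = ρ (applicants pref (Function.update rest c ρ) c) := by
  rw [rejections_apply, Function.update_self]

theorem rejections_update_le {ρ ρ' : Set S →o Set S}
    (h : ∀ x ∈ ρ (cumApps pref (rejections pref (Function.update rest c ρ)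
        ⊓ rejections pref (Function.update rest c ρ')) c),
      x ∈ rejections pref (Function.update rest c ρ) c →
        x ∈ rejections pref (Function.update rest c ρ') c) :
    rejections pref (Function.update rest c ρ) ≤ rejections pref (Function.update rest c ρ') := by
  refine rejections_le_of_college pref c (fun d hd => ?_) fun x hx => h x ?_
  · rw [Function.update_of_ne hd, Function.update_of_ne hd]
  · rwa [Function.update_self] at hx

variable [Fintype S]

theorem ncard_held_update_anti [Fintype C]
    (hmono : ∀ d, ∀ X Y : Set S, X ⊆ Y → (X \ rest d X).ncard ≤ (Y \ rest d Y).ncard)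
    {ρ ρ' : Set S →o Set S}
    (hle : rejections pref (Function.update rest c ρ)
      ≤ rejections pref (Function.update rest c ρ')) :
    (held pref (Function.update rest c ρ') c).ncard
      ≤ (held pref (Function.update rest c ρ) c).ncard := by
  refine ncard_held_anti pref c (fun d hd => ?_) (fun d hd => ?_) hle
  · rw [Function.update_of_ne hd, Function.update_of_ne hd]
  · rw [Function.update_of_ne hd]
    exact hmono d

theorem held_quotaRule (P : LinearOrder S) (q : ℕ) :
    held pref (Function.update rest c (quotaRule P q)) c
      = applicants pref (Function.update rest c (quotaRule P q)) c
        \ quotaRule P q (applicants pref (Function.update rest c (quotaRule P q)) c) := by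
  rw [held, rejections_update]

/-- A college that rejects nobody gets no new applicants from changing its list. -/
theorem held_subset_of_rejections_eq_empty (P P' : LinearOrder S) (q : ℕ)
    (h : rejections pref (Function.update rest c (quotaRule P q)) c = ∅) :
    held pref (Function.update rest c (quotaRule P' q)) c
      ⊆ held pref (Function.update rest c (quotaRule P q)) c := by
  have hcard : (applicants pref (Function.update rest c (quotaRule P q)) c).ncard ≤ q := by
    have := ncard_diff_quotaRule_le P q
      (applicants pref (Function.update rest c (quotaRule P q)) c)
    rwa [← rejections_update, h, sdiff_empty] at this
  have hle : rejections pref (Function.update rest c (quotaRule P' q))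
      ≤ rejections pref (Function.update rest c (quotaRule P q)) := by
    refine rejections_update_le pref rest c fun x hx _ => absurd hx.2 (not_le.2 ?_)
    refine (ncard_lt_ncard ⟨fun y hy => cumApps_inf_subset pref c hy.1, fun hsub => ?_⟩
      (toFinite _)).trans_le hcard
    let := P'
    exact lt_irrefl x (hsub (cumApps_inf_subset pref c hx.1)).2
  intro x hx
  refine ⟨applicants_mono pref _ hle c hx.1, ?_⟩
  rw [h]
  exact notMem_empty x

/-- Some student rejected by `c` may be kept by `c` as an additional student without affecting
the applications of the other students accepted by `c`. -/
theorem exists_last_rejected (P : LinearOrder S) (q : ℕ)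
    (hne : (rejections pref (Function.update rest c (quotaRule P q)) c).Nonempty) :
    ∃ z ∈ rejections pref (Function.update rest c (quotaRule P q)) c,
      rejections pref (Function.update rest c
          (avoidRule (rejections pref (Function.update rest c (quotaRule P q)) c \ {z})))
        ≤ rejections pref (Function.update rest c (quotaRule P q)) ∧
      q + 1 ≤ (held pref (Function.update rest c
          (avoidRule (rejections pref (Function.update rest c (quotaRule P q)) c \ {z}))) c).ncard
    := by
  let := P
  obtain ⟨z, hz, hmax⟩ := exists_max_image _ id (toFinite _) hne
  refine ⟨z, hz, ?_⟩
  set R := rejections pref (Function.update rest c (quotaRule P q))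
  set A := applicants pref (Function.update rest c (quotaRule P q))
  set ρ := avoidRule (R c \ {z})
  have hle : rejections pref (Function.update rest c ρ) ≤ R :=
    rejections_update_le pref rest c fun x hx _ => hx.2.1
  refine ⟨hle, ?_⟩
  have hRc : R c = quotaRule P q (A c) := rejections_update pref rest c _
  have hzρ : z ∉ rejections pref (Function.update rest c ρ) c := by
    rw [rejections_update]
    exact fun h => h.2.2 rfl
  have happ : applicants pref (Function.update rest c ρ) c ⊆ A c := applicants_mono pref _ hle c
  have hall : insert z (A c \ R c) ⊆ applicants pref (Function.update rest c ρ) c := by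
    by_contra hn
    refine hzρ (rejections_update_le pref rest c (fun x hx hxR => ?_) c hz)
    have hxA := cumApps_inf_subset pref c hx.1
    by_cases hxz : x = z
    · subst hxz
      have hsub : {y | y ∈ cumApps pref (rejections pref (Function.update rest c (quotaRule P q))
          ⊓ rejections pref (Function.update rest c ρ)) c ∧ P.lt x y} ⊆ A c \ R c := fun y hy =>
        ⟨happ (cumApps_inf_subset pref c hy.1), fun hyR => absurd hy.2 (not_lt.2 (hmax y hyR))⟩
      have heq := eq_of_subset_of_ncard_le hsub
        ((hRc ▸ ncard_diff_quotaRule_le P q (A c)).trans hx.2) (toFinite _)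
      refine absurd (insert_subset hxA fun y hy => ?_) hn
      rw [← heq] at hy
      exact cumApps_inf_subset pref c hy.1
    · rw [rejections_update]
      exact ⟨hxA, hxR, hxz⟩
  have hsub : insert z (A c \ R c) ⊆ held pref (Function.update rest c ρ) c := by
    refine fun y hy => ⟨hall hy, ?_⟩
    rw [rejections_update]
    rintro ⟨-, hyR, hyz⟩
    rcases hy with rfl | hy
    · exact hyz rfl
    · exact hy.2 hyR
  refine le_trans ?_ (ncard_le_ncard hsub (toFinite _))
  rw [ncard_insert_of_notMem (fun h => h.2 hz) (toFinite _), hRc]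
  exact Nat.add_le_add_right (le_ncard_diff_quotaRule P q (A c) (hRc ▸ hne)) 1

open Classical in
/-- Suppose `c` fills its quota under the lists `P₀` and `P`, loses `s` by switching from
`P₀` to `P`, and all students gained are preferred to `s` under `P₀`. Then some list makes `c`
exchange `s`, and nobody else, for a student preferred to `s`. -/
theorem exists_list_exchanging [Fintype C]
    (hmono : ∀ d, ∀ X Y : Set S, X ⊆ Y → (X \ rest d X).ncard ≤ (Y \ rest d Y).ncard)
    (P₀ P : LinearOrder S) (q : ℕ)
    (hne : (rejections pref (Function.update rest c (quotaRule P₀ q)) c).Nonempty)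
    {s : S} (hs : s ∈ held pref (Function.update rest c (quotaRule P₀ q)) c)
    (hs' : s ∉ held pref (Function.update rest c (quotaRule P q)) c)
    (hnew : ∀ x ∈ held pref (Function.update rest c (quotaRule P q)) c,
      x ∉ held pref (Function.update rest c (quotaRule P₀ q)) c → P₀.lt s x) :
    ∃ (P' : LinearOrder S) (u : S),
      u ∉ held pref (Function.update rest c (quotaRule P₀ q)) c ∧ P₀.lt s u ∧
      held pref (Function.update rest c (quotaRule P' q)) c
        = insert u (held pref (Function.update rest c (quotaRule P₀ q)) c \ {s}) := by
  let := P₀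
  set X := held pref (Function.update rest c (quotaRule P₀ q)) c with hX
  set X' := held pref (Function.update rest c (quotaRule P q)) c
  set R := rejections pref (Function.update rest c (quotaRule P₀ q))
  set R' := rejections pref (Function.update rest c (quotaRule P q)) with hR'
  have hRc : R c = quotaRule P₀ q (applicants pref (Function.update rest c (quotaRule P₀ q)) c) :=
    rejections_update pref rest c _
  have hXcard : X.ncard = q := by
    rw [hX, held_quotaRule]
    exact (ncard_diff_quotaRule_le _ _ _).antisymm (le_ncard_diff_quotaRule _ _ _ (hRc ▸ hne))
  have hXs : (X \ {s}).ncard < q := by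
    have := ncard_sdiff_singleton_add_one hs (toFinite _)
    omega
  have hRs : ∀ x ∈ R c, x < s := fun x hx =>
    lt_of_mem_quotaRule P₀ q _ (hRc ▸ hx) (held_quotaRule pref rest c P₀ q ▸ hs)
  have hRX : ∀ x ∈ R c, x ∉ X := fun x hx h => h.2 hx
  have hRR' : R ≤ R' := by
    refine rejections_update_le pref rest c fun x hx hxR => ?_
    by_contra hxn
    exact lt_asymm (hRs x hxR)
      (hnew x ⟨cumApps_inf_subset pref c hx.1, hxn⟩ (hRX x hxR))
  obtain ⟨z, hz, hle, hcard⟩ := exists_last_rejected pref rest c P q (hne.mono (hRR' c))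
  rw [← hR'] at hz hle hcard
  set ρ := avoidRule (R' c \ {z})
  have happρ := applicants_mono pref _ hle c
  -- Raising `z` just below `X` keeps every student of `X` applying to `c`.
  set t₁ : S → ℕ := fun x => if x ∈ X then 2 else if x = z then 1 else 0 with ht₁
  set R₁ := rejections pref (Function.update rest c (quotaRule (tiered P₀ t₁) q))
  have hR₁R : R₁ ≤ R := by
    refine rejections_update_le pref rest c fun x hx _ => ?_
    by_contra hxn
    have hxX : x ∈ X := ⟨cumApps_inf_subset pref c hx.1, hxn⟩
    refine absurd hx.2 (not_le.2 (hXcard ▸ ncard_lt_ncard (ssubset_iff_of_subset ?_ |>.2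
      ⟨x, hxX, fun h => ?_⟩) (toFinite _)))
    · intro y hy
      have := hy.2
      rw [tiered_lt] at this
      simp only [ht₁, if_pos hxX] at this
      by_contra hyX
      rw [if_neg hyX] at this
      obtain h | ⟨h, -⟩ := this <;> split_ifs at h <;> omega
    · let := tiered P₀ t₁
      exact lt_irrefl x h.2
  have hzR₁ : z ∈ R₁ c := by
    by_contra hzn
    have hle₁ : R₁ ≤ rejections pref (Function.update rest c ρ) := by
      refine rejections_update_le pref rest c fun x hx hxR => ?_
      rw [rejections_update]
      exact ⟨cumApps_inf_subset pref c hx.1, hRR' c (hR₁R c hxR), fun h => hzn (h ▸ hxR)⟩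
    have h1 := ncard_held_update_anti pref rest c hmono hle₁
    have h2 := ncard_diff_quotaRule_le (tiered P₀ t₁) q
      (applicants pref (Function.update rest c (quotaRule (tiered P₀ t₁) q)) c)
    rw [← held_quotaRule] at h2
    omega
  have hzX : z ∉ X := hRX z (hR₁R c hzR₁)
  have hzs : z < s := hRs z (hR₁R c hzR₁)
  have hz_better : ∀ y, (tiered P₀ t₁).lt z y → y ∈ X := by
    intro y hy
    rw [tiered_lt] at hy
    simp only [ht₁, if_neg hzX, if_true] at hy
    by_contra hyX
    rw [if_neg hyX] at hy
    by_cases hyz : y = z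
    · subst hyz
      simp at hy
    · simp [hyz] at hy
  have hX_of_better : ∀ Y : Set S, z ∈ quotaRule (tiered P₀ t₁) q Y → X ⊆ Y := by
    intro Y hzY
    have hsub : {y | y ∈ Y ∧ (tiered P₀ t₁).lt z y} ⊆ X := fun y hy => hz_better y hy.2
    have heq := eq_of_subset_of_ncard_le hsub (hXcard.le.trans hzY.2) (toFinite _)
    intro y hy
    rw [← heq] at hy
    exact hy.1
  have hXA₁ : X ⊆ applicants pref (Function.update rest c (quotaRule (tiered P₀ t₁) q)) c := by
    refine hX_of_better _ ?_
    rw [← rejections_update]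
    exact hzR₁
  -- The manipulation: drop `s` below `z`, and below everybody preferred to `s`.
  set t₂ : S → ℕ := fun x => if x ∈ X \ {s} then 3 else if s < x then 2 else
    if x = z then 1 else 0 with ht₂
  set R₂ := rejections pref (Function.update rest c (quotaRule (tiered P₀ t₂) q))
  set A₂ := applicants pref (Function.update rest c (quotaRule (tiered P₀ t₂) q)) c
  have hXA₂ : X ⊆ A₂ := by
    by_contra hn
    have hle₂ : R₁ ≤ R₂ := by
      refine rejections_update_le pref rest c fun x hx hxR => ?_
      have hxz : x ≠ z := by
        rintro rfl
        exact hn ((hX_of_better _ hx).trans (cumApps_inf_subset pref c))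
      have hxX : x ∉ X := hRX x (hR₁R c hxR)
      have hxs : x < s := hRs x (hR₁R c hxR)
      rw [rejections_update]
      refine ⟨cumApps_inf_subset pref c hx.1, hx.2.trans (ncard_le_ncard (fun y hy =>
        ⟨cumApps_inf_subset pref c hy.1, ?_⟩) (toFinite _))⟩
      have hxy := hy.2
      rw [tiered_lt] at hxy
      rw [tiered_lt]
      simp only [ht₁, ht₂, hxX, hxz, lt_asymm hxs, mem_sdiff, mem_singleton_iff, false_and,
        if_false] at hxy ⊢
      by_cases hys : y = s
      · subst hys
        have hyz : y ≠ z := hzs.ne'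
        right
        simpa [hyz] using hxs
      · by_cases hyX : y ∈ X
        · left; simp [hyX, hys]
        · by_cases hsy : s < y
          · left; simp [hyX, hsy]
          · by_cases hyz : y = z
            · left; rw [if_neg (fun h => hyX h.1), if_neg hsy, if_pos hyz]; exact one_pos
            · right; simpa [hyX, hsy, hyz] using hxy
    exact hn (hXA₁.trans (applicants_mono pref _ hle₂ c))
  have hz_better₂ : ∀ y, (tiered P₀ t₂).lt z y → y ∈ X \ {s} ∨ s < y := by
    intro y hy
    rw [tiered_lt] at hy
    simp only [ht₂] at hy
    by_contra! hyn
    rw [if_neg (fun h => hzX h.1), if_neg (lt_asymm hzs), if_pos trivial, if_neg hyn.1,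
      if_neg (not_lt.2 hyn.2)] at hy
    by_cases hyz : y = z
    · subst hyz
      simp at hy
    · simp [hyz] at hy
  have htop : ∀ x, x ∈ X \ {s} → ∀ y, (tiered P₀ t₂).lt x y → y ∈ X \ {s} := by
    intro x hx y hy
    rw [tiered_lt] at hy
    simp only [ht₂, if_pos hx] at hy
    by_contra hyn
    rw [if_neg hyn] at hy
    obtain h | ⟨h, -⟩ := hy <;> split_ifs at h <;> omega
  have hmid : ∃ u ∈ A₂, s < u ∧ u ∉ X := by
    by_contra! hn
    have hle₂ : R₂ ≤ rejections pref (Function.update rest c ρ) := by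
      refine rejections_update_le pref rest c fun x hx hxR => ?_
      have hxA := cumApps_inf_subset pref c hx.1
      have hbetter : q ≤ {y | y ∈ A₂ ∧ (tiered P₀ t₂).lt x y}.ncard := by
        rw [rejections_update] at hxR
        exact hxR.2
      have hxA₂ : x ∈ A₂ := by
        rw [rejections_update] at hxR
        exact hxR.1
      have hxtop : x ∉ X \ {s} := fun h => absurd hbetter (not_le.2
        ((ncard_le_ncard (fun y hy => htop x h y hy.2) (toFinite _)).trans_lt hXs))
      have hxz : x ≠ z := by
        rintro rfl
        refine absurd hbetter (not_le.2
          ((ncard_le_ncard (fun y hy => ?_) (toFinite _)).trans_lt hXs))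
        rcases hz_better₂ y hy.2 with h | h
        · exact h
        · exact ⟨hn y hy.1 h, h.ne'⟩
      rw [rejections_update]
      refine ⟨hxA, ?_, hxz⟩
      by_contra hxn
      have hxX' : x ∈ X' := ⟨happρ hxA, hxn⟩
      by_cases hxX : x ∈ X
      · have hxs : x = s := by
          by_contra h
          exact hxtop ⟨hxX, h⟩
        exact hs' (hxs ▸ hxX')
      · exact hxX (hn x hxA₂ (hnew x hxX' hxX))
    have h1 := ncard_held_update_anti pref rest c hmono hle₂
    have h2 := ncard_diff_quotaRule_le (tiered P₀ t₂) q A₂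
    rw [← held_quotaRule] at h2
    omega
  obtain ⟨u, ⟨huA, hsu, huX⟩, hmax⟩ :=
    exists_max_image {u | u ∈ A₂ ∧ s < u ∧ u ∉ X} id (toFinite _) hmid
  refine ⟨tiered P₀ t₂, u, huX, hsu, ?_⟩
  have hsub : insert u (X \ {s})
      ⊆ held pref (Function.update rest c (quotaRule (tiered P₀ t₂) q)) c := by
    rw [held_quotaRule]
    refine insert_subset ⟨huA, fun h => absurd h.2 (not_le.2
      ((ncard_le_ncard (fun y hy => ?_) (toFinite _)).trans_lt hXs))⟩ fun x hx =>
      ⟨hXA₂ hx.1, fun h => absurd h.2 (not_le.2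
        ((ncard_le_ncard (fun y hy => htop x hx y hy.2) (toFinite _)).trans_lt hXs))⟩
    obtain ⟨hyA, hy⟩ := hy
    rw [tiered_lt] at hy
    simp only [ht₂] at hy
    rw [if_neg (fun h => huX h.1), if_pos hsu] at hy
    by_contra hyn
    rw [if_neg hyn] at hy
    by_cases hsy : s < y
    · refine absurd (hmax y ⟨hyA, hsy, fun h => hyn ⟨h, hsy.ne'⟩⟩) (not_le.2 ?_)
      simpa [hsy] using hy
    · rw [if_neg hsy] at hy
      obtain h | ⟨h, -⟩ := hy <;> split_ifs at h <;> omega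
  refine (eq_of_subset_of_ncard_le hsub ?_ (toFinite _)).symm
  rw [ncard_insert_of_notMem (fun h => huX h.1) (toFinite _),
    ncard_sdiff_singleton_add_one hs (toFinite _), hXcard, held_quotaRule]
  exact ncard_diff_quotaRule_le _ _ _

end OneCollege

/-- If `X` responsively dominates a set `Y` of the same size and differs from it, then some
student lost from `Y` is worse than all students gained. -/
theorem RespDominates.exists_worst_lost {S C : Type*} [Fintype S] [Fintype C] {M : Market S C}
    {c : C} {X Y : Finset S} (h : RespDominates M c X Y) (hne : X ≠ Y)
    (hcard : X.card ≤ Y.card) :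
    ∃ s ∈ Y, s ∉ X ∧ ∀ x ∈ X, x ∉ Y → M.cprefers c x s := by
  classical
  let := M.cPref c
  obtain ⟨g, hinj, hmem, hge⟩ := h
  have hYX : (Y \ X).Nonempty := by
    rw [Finset.sdiff_nonempty]
    exact fun hsub => hne (Finset.eq_of_subset_of_card_le hsub hcard).symm
  obtain ⟨s, hs, hmin⟩ := Finset.exists_min_image (Y \ X) id hYX
  obtain ⟨hsY, hsX⟩ := Finset.mem_sdiff.1 hs
  refine ⟨s, hsY, hsX, fun x hx hxY => ?_⟩
  by_contra hxs
  have hlt : x < s := (not_lt.1 hxs).lt_of_ne fun e => hsX (e ▸ hx)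
  have hup : (Y.filter (s ≤ ·)).card ≤ (X.filter (s ≤ ·)).card := by
    refine Finset.card_le_card_of_injOn g (fun y hy => ?_) (hinj.mono fun y hy => ?_)
    · rw [Finset.mem_coe, Finset.mem_filter] at hy ⊢
      refine ⟨hmem y hy.1, hy.2.trans ?_⟩
      rcases hge y hy.1 with e | e
      · exact e.ge
      · exact le_of_lt e
    · exact (Finset.mem_filter.1 (Finset.mem_coe.1 hy)).1
  have hdown : (Y.filter (¬ s ≤ ·)).card < (X.filter (¬ s ≤ ·)).card := by
    refine Finset.card_lt_card (Finset.ssubset_iff_of_subset (fun y hy => ?_) |>.2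
      ⟨x, Finset.mem_filter.2 ⟨hx, not_le.2 hlt⟩, fun h => hxY (Finset.mem_filter.1 h).1⟩)
    rw [Finset.mem_filter] at hy ⊢
    refine ⟨?_, hy.2⟩
    by_contra hyX
    exact hy.2 (hmin y (Finset.mem_sdiff.2 ⟨hy.1, hyX⟩))
  have h1 := Finset.card_filter_add_card_filter_not (s := X) (s ≤ ·)
  have h2 := Finset.card_filter_add_card_filter_not (s := Y) (s ≤ ·)
  omega

theorem RespDominates.card_le {S C : Type*} [Fintype S] [Fintype C] {M : Market S C}
    {c : C} {X Y : Finset S} (h : RespDominates M c X Y) : Y.card ≤ X.card := by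
  obtain ⟨g, hinj, hmem, -⟩ := h
  exact Finset.card_le_card_of_injOn g hmem hinj

end DeferredAcceptance

/-- If a college `c` can beneficially manipulate the student-optimal
stable mechanism, then there exists a beneficial manipulation by `c` whose outcome
`μ''` loses exactly one of `c`'s truthful matches: `|μ(c) \\ μ''(c)| = 1`. -/
theorem stmt_5 {S C : Type*} [Fintype S] [Fintype C] [DecidableEq S] [DecidableEq C]
    (M : Market S C) (c : C) (P : LinearOrder S)
    (μ : Matching M) (μ' : Matching (replaceCPref M c P))
    (hμ : StudentOptimal M μ) (hμ' : StudentOptimal (replaceCPref M c P) μ')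
    (hben : StrictRespDominates M c (μ'.assign c) (μ.assign c)) :
    ∃ (P'' : LinearOrder S) (μ'' : Matching (replaceCPref M c P'')),
      StudentOptimal (replaceCPref M c P'') μ'' ∧
      StrictRespDominates M c (μ''.assign c) (μ.assign c) ∧
      (μ.assign c \ μ''.assign c).card = 1 := by
  have hcoe' (P' : LinearOrder S) (ν : Matching (replaceCPref M c P'))
      (hν : StudentOptimal (replaceCPref M c P') ν) :
      (ν.assign c : Set S) = held M.sPref (Function.update M.rules c (quotaRule P' (M.q c))) c := by
    rw [hν.coe_assign, rules_replaceCPref]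
    rfl
  have hcoe : (μ.assign c : Set S)
      = held M.sPref (Function.update M.rules c (quotaRule (M.cPref c) (M.q c))) c := by
    rw [hμ.coe_assign, show quotaRule (M.cPref c) (M.q c) = M.rules c from rfl,
      Function.update_eq_self]
  have hcoeP := hcoe' P μ' hμ'
  obtain ⟨hne, hdom⟩ := hben
  have hrej : (rejections M.sPref
      (Function.update M.rules c (quotaRule (M.cPref c) (M.q c))) c).Nonempty := by
    rw [Set.nonempty_iff_ne_empty]
    intro hemp
    have hsub := held_subset_of_rejections_eq_empty M.sPref M.rules c _ P _ hemp
    rw [← hcoe, ← hcoeP, Finset.coe_subset] at hsub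
    exact hne (Finset.eq_of_subset_of_card_le hsub hdom.card_le)
  have hfull : M.q c ≤ (μ.assign c).card := by
    rw [← Set.ncard_coe_finset, hcoe, held_quotaRule]
    rw [rejections_update] at hrej
    exact le_ncard_diff_quotaRule _ _ _ hrej
  obtain ⟨s, hs, hs', hnew⟩ := hdom.exists_worst_lost hne ((μ'.card_le c).trans hfull)
  obtain ⟨P'', u, hu, hsu, heq⟩ := exists_list_exchanging M.sPref M.rules c
    (fun d X Y h => ncard_diff_quotaRule_mono _ _ X h) (M.cPref c) P (M.q c) hrej (s := s)
    (hcoe ▸ hs) (hcoeP ▸ hs') fun x hx hxn => hnew x (by rwa [← hcoeP] at hx)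
      fun h => hxn (hcoe ▸ h)
  refine ⟨P'', daMatching _, daMatching_studentOptimal _, ?_⟩
  rw [← hcoe, ← hcoe' P'' _ (daMatching_studentOptimal _)] at heq
  rw [← hcoe] at hu
  have hassign : (daMatching (replaceCPref M c P'')).assign c
      = insert u ((μ.assign c).erase s) := by
    apply Finset.coe_injective
    rw [heq, Finset.coe_insert, Finset.coe_erase]
  have hus : u ≠ s := fun h => hu (h ▸ hs)
  have hu : u ∉ μ.assign c := hu
  rw [hassign]
  refine ⟨⟨fun h => hu (h ▸ Finset.mem_insert_self _ _), fun x => if x = s then u else x,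
    ?_, ?_, ?_⟩, ?_⟩
  · intro x hx y hy hxy
    have hx : x ∈ μ.assign c := hx
    have hy : y ∈ μ.assign c := hy
    grind
  · intro x hx
    grind
  · intro x hx
    by_cases h : x = s
    · right
      simp only [h, if_true]
      exact hsu
    · left
      simp [h]
  · rw [Finset.card_eq_one]
    refine ⟨s, ?_⟩
    clear hsu
    grind
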